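/- arXiv:2108.10940 — 2 statements merged into one kernel-verified Lean document; each statement's English description precedes it below -/
import Mathlib

section
/- Let L be a line in the Euclidean plane (a nonempty one-dimensional affine subspace of ℝ²), and let x and y be points with x ∉ L, y ∉ L, and such that the closed segment joining x and y is disjoint from L (i.e., x and y lie strictly on the same side of L). Then there exists a unique point m ∈ L such that for every point p ∈ L, dist(x, m) + dist(m, y) ≤ dist(x, p) + dist(p, y). (Uniqueness of the specular bounce point: a single specular reflection connecting x to y through the mirror line L occurs at exactly one point of L.) -/
open EuclideanGeometry in
/-- Uniqueness of the specular bounce point: if `x` and `y` lie strictly on the same side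
of the mirror line `L` (their segment is disjoint from `L` and neither lies on `L`), then
there is a unique point `m` of `L` minimizing `dist x m + dist m y` over all points of `L`. -/
theorem unique_specular_bounce_point
    (L : AffineSubspace ℝ (EuclideanSpace ℝ (Fin 2))) [Nonempty L]
    (hL : Module.finrank ℝ L.direction = 1)
    (x y : EuclideanSpace ℝ (Fin 2)) (hx : x ∉ L) (hy : y ∉ L)
    (hseg : Disjoint (segment ℝ x y) (L : Set (EuclideanSpace ℝ (Fin 2)))) :
    ∃! m : EuclideanSpace ℝ (Fin 2), m ∈ L ∧
      ∀ p ∈ L, dist x m + dist m y ≤ dist x p + dist p y := by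
  have hperp : Module.finrank ℝ L.directionᗮ = 1 := by
    have h := Submodule.finrank_add_finrank_orthogonal L.direction
    rw [hL, finrank_euclideanSpace_fin] at h
    omega
  obtain ⟨fx, hfx, hux⟩ : ∃ fx ∈ L, x - fx ∈ L.directionᗮ :=
    ⟨orthogonalProjection L x, orthogonalProjection_mem x,
      vsub_orthogonalProjection_mem_direction_orthogonal L x⟩
  obtain ⟨fy, hfy, huy, hrefl⟩ : ∃ fy ∈ L, y - fy ∈ L.directionᗮ ∧
      ∀ p ∈ L, dist p y = dist p (fy - (y - fy)) := by
    refine ⟨orthogonalProjection L y, orthogonalProjection_mem y,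
      vsub_orthogonalProjection_mem_direction_orthogonal L y, fun p hp => ?_⟩
    rw [← dist_reflection_eq_of_mem L hp y, reflection_apply']
    congr 1
    simp only [vsub_eq_sub, vadd_eq_add]
    abel
  obtain ⟨u, hu⟩ : ∃ u, u = x - fx := ⟨_, rfl⟩
  have hxe : x = fx + u := by rw [hu]; abel
  rw [← hu] at hux
  have hu0 : u ≠ 0 := by
    rintro rfl
    exact hx (by rw [hxe, add_zero]; exact hfx)
  obtain ⟨c, hc⟩ : ∃ c : ℝ, c • u = y - fy := by
    have := (finrank_eq_one_iff_of_nonzero' (⟨u, hux⟩ : L.directionᗮ) (by simpa using hu0)).1 hperp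
      ⟨_, huy⟩
    obtain ⟨c, hc⟩ := this
    exact ⟨c, congrArg Subtype.val hc⟩
  have hye : y = fy + c • u := by rw [hc]; abel
  have hc0 : 0 < c := by
    by_contra hneg
    have h1 : 0 < 1 - c := by linarith
    have hd := Set.disjoint_left.1 hseg
    refine @hd (AffineMap.lineMap fx fy (1 / (1 - c))) ?_
      (AffineMap.lineMap_mem _ hfx hfy)
    rw [segment_eq_image_lineMap]
    refine ⟨1 / (1 - c), ⟨by positivity, by rw [div_le_one h1]; linarith⟩, ?_⟩
    rw [hxe, hye]
    simp only [AffineMap.lineMap_apply_module]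
    match_scalars <;> field_simp <;> ring
  rw [← hc] at hrefl
  obtain ⟨y', hy'⟩ : ∃ y', y' = fy - c • u := ⟨_, rfl⟩
  rw [← hy'] at hrefl
  have h1 : 0 < 1 + c := by linarith
  obtain ⟨m, hm⟩ : ∃ m, m = AffineMap.lineMap x y' (1 / (1 + c)) := ⟨_, rfl⟩
  have hmL : m ∈ L := by
    have : m = AffineMap.lineMap fx fy (1 / (1 + c)) := by
      rw [hm, hxe, hy']
      simp only [AffineMap.lineMap_apply_module]
      match_scalars <;> field_simp <;> ring
    rw [this]
    exact AffineMap.lineMap_mem _ hfx hfy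
  have hmb : dist x m + dist m y' = dist x y' := by
    apply Wbtw.dist_add_dist
    exact ⟨1 / (1 + c), ⟨by positivity, by rw [div_le_one h1]; linarith⟩, hm.symm⟩
  refine ⟨m, ⟨hmL, fun p hp => ?_⟩, ?_⟩
  · rw [hrefl m hmL, hrefl p hp, hmb]
    exact dist_triangle _ _ _
  · rintro p ⟨hp, hmin⟩
    have h2 := hmin m hmL
    rw [hrefl m hmL, hrefl p hp, hmb] at h2
    obtain ⟨t, -, ht⟩ := dist_add_dist_eq_iff.1 (le_antisymm h2 (dist_triangle _ _ _))
    have hz : (1 - t * (1 + c)) • u ∈ L.direction := by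
      have e : (1 - t * (1 + c)) • u = p - AffineMap.lineMap fx fy t := by
        rw [← ht, hxe, hy']
        simp only [AffineMap.lineMap_apply_module]
        module
      rw [e]
      exact AffineSubspace.vsub_mem_direction hp (AffineMap.lineMap_mem _ hfx hfy)
    have hz0 : (1 - t * (1 + c)) • u = 0 := by
      have := Submodule.inner_right_of_mem_orthogonal hz (Submodule.smul_mem _ (1 - t * (1 + c)) hux)
      exact inner_self_eq_zero.1 this
    have ht' : t = 1 / (1 + c) := by
      rcases smul_eq_zero.1 hz0 with h | h
      · field_simp; linarith
      · exact absurd h hu0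
    rw [← ht, hm, ht']
end

section
/- For every natural number n ≥ 1, define the comb region Pₙ ⊆ ℝ² by Pₙ = ([0, 3n] × [1, 2]) ∪ ⋃_{i=0}^{n−1} ([3i, 3i+1] × [0, 1]) (a horizontal strip with n downward teeth). If G ⊆ Pₙ is a finite set of points such that every point p ∈ Pₙ is directly visible from some g ∈ G — that is, the closed segment joining g and p is contained in Pₙ — then |G| ≥ n. Hence, without reflection, Θ(n) guards are required to cover such polygons (whereas with single specular reflection-edges a single guard can suffice). -/
/-- The comb region `Pₙ ⊆ ℝ²`: a horizontal strip `[0, 3n] × [1, 2]` together with `n`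
downward teeth `[3i, 3i+1] × [0, 1]` for `i = 0, …, n-1`. -/
def comb (n : ℕ) : Set (ℝ × ℝ) :=
  (Set.Icc (0 : ℝ) (3 * n) ×ˢ Set.Icc (1 : ℝ) 2) ∪
    ⋃ i ∈ Finset.range n, Set.Icc (3 * (i : ℝ)) (3 * (i : ℝ) + 1) ×ˢ Set.Icc (0 : ℝ) 1

theorem comb_key (n i : ℕ) (g : ℝ × ℝ) (hg : g ∈ comb n)
    (hs : segment ℝ g (3 * (i : ℝ) + 1 / 2, 0) ⊆ comb n) :
    |g.1 - (3 * (i : ℝ) + 1 / 2)| ≤ 1 := by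
  obtain ⟨x, y⟩ := g
  have hy : y ≤ 2 := by
    simp only [comb, Set.mem_union, Set.mem_prod, Set.mem_Icc, Set.mem_iUnion] at hg
    rcases hg with h | ⟨j, hj, h⟩
    · exact h.2.2
    · linarith [h.2.2]
  by_contra hd
  push Not at hd
  simp only at hd
  set d := x - (3 * (i : ℝ) + 1 / 2) with hdd
  obtain ⟨t, ht⟩ : ∃ t : ℝ, t = 1 / (|d| + 1) := ⟨_, rfl⟩
  have ht0 : 0 < t := by rw [ht]; positivity
  have htd : t * |d| + t = 1 := by rw [ht]; field_simp
  have ht2 : t < 1 / 2 := by nlinarith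
  have hm : (3 * (i : ℝ) + 1 / 2 + t * d, t * y) ∈ comb n := by
    apply hs
    refine ⟨t, 1 - t, ht0.le, by linarith, by ring, ?_⟩
    ext
    · simp [hdd]; ring
    · simp
  have hty : t * y < 1 := by nlinarith
  simp only [comb, Set.mem_union, Set.mem_prod, Set.mem_Icc, Set.mem_iUnion] at hm
  rcases hm with h | ⟨j, hj, ⟨h1, h2⟩, h⟩
  · linarith [h.2.1]
  · rcases lt_trichotomy i j with hij | hij | hij
    · have : (i : ℝ) + 1 ≤ j := by exact_mod_cast hij
      nlinarith [le_abs_self d]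
    · subst hij
      rcases abs_cases d with ⟨h3, h4⟩ | ⟨h3, h4⟩ <;> rw [h3] at htd <;> nlinarith
    · have : (j : ℝ) + 1 ≤ i := by exact_mod_cast hij
      nlinarith [neg_abs_le d]

/-- Without reflection, `Θ(n)` guards are required on the comb: any finite set of guards
inside `Pₙ` from which every point of `Pₙ` is directly visible has at least `n` guards. -/
theorem comb_needs_n_guards (n : ℕ) (hn : 1 ≤ n)
    (G : Finset (ℝ × ℝ)) (hG : ↑G ⊆ comb n)
    (hcover : ∀ p ∈ comb n, ∃ g ∈ G, segment ℝ g p ⊆ comb n) :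
    n ≤ G.card := by
  have hp : ∀ i : ℕ, i ∈ Finset.range n → ∃ g ∈ G, |g.1 - (3 * (i : ℝ) + 1 / 2)| ≤ 1 := by
    intro i hi
    obtain ⟨g, hg, hs⟩ := hcover (3 * (i : ℝ) + 1 / 2, 0) (by
      simp only [comb, Set.mem_union, Set.mem_prod, Set.mem_Icc, Set.mem_iUnion]
      exact Or.inr ⟨i, hi, ⟨by linarith, by linarith⟩, by norm_num, by norm_num⟩)
    exact ⟨g, hg, comb_key n i g (hG hg) hs⟩
  choose! f hf hf' using hp
  have := Finset.card_le_card_of_injOn f hf (s := Finset.range n) (t := G) (by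
    intro i hi j hj hij
    have h1 := abs_le.1 (hf' i hi)
    have h2 := abs_le.1 (hf' j hj)
    rw [hij] at h1
    rcases lt_trichotomy i j with h | h | h
    · have : (i : ℝ) + 1 ≤ j := by exact_mod_cast h
      linarith [h1.1, h1.2, h2.1, h2.2]
    · exact h
    · have : (j : ℝ) + 1 ≤ i := by exact_mod_cast h
      linarith [h1.1, h1.2, h2.1, h2.2])
  simpa using this
end
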